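/- Empty clipped cells: under greedy ordering with freezing times λ_j ≥ ((1+ε)/ε) r_j, for every k ≥ 1 and every α > (1+ε)λ_k, the clipped Voronoi cell V_k^α = Vor_{P̂(α)}(p_k) ∩ ball(p_k, min(λ_k, α)) is empty. Concretely: for every x with ‖x − p_k‖ ≤ λ_k, there exists i ≠ k with sqrt(‖x − p_i‖² + w_i(α)²) < sqrt(‖x − p_k‖² + w_k(α)²). -/

import Mathlib

open Metric Set

/-- Empty clipped cells: under a greedy ordering with freezing times
`λ j ≥ ((1+ε)/ε) r j` (and `λ 0` large enough), for every `k ≥ 1` and every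
scale `α > (1+ε) λ k`, the clipped Voronoi cell of `p k` is empty.  Concretely,
every `x` with `dist x (p k) ≤ λ k` has some other point `p i` strictly closer
in weighted distance. -/
theorem empty_clipped_cells
    {d n : ℕ} (p : ℕ → EuclideanSpace ℝ (Fin d))
    (r lam : ℕ → ℝ) (ε : ℝ) (hε : 0 < ε)
    (hr : ∀ i, i < n → r i = Metric.infDist (p i) (p '' Set.Iio i))
    (hgreedy : ∀ i j, i ≤ j → j < n →
      Metric.infDist (p j) (p '' Set.Iio i) ≤ Metric.infDist (p i) (p '' Set.Iio i))
    (hlam : ∀ j, 1 ≤ j → j < n → (1 + ε) / ε * r j ≤ lam j)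
    (hlampos : ∀ j, j < n → 0 < lam j)
    (w : ℕ → ℝ → ℝ)
    (hw : ∀ i s, w i s = if s < lam i then 0 else Real.sqrt (s ^ 2 - (lam i) ^ 2))
    (k : ℕ) (hk : 1 ≤ k) (hkn : k < n)
    (hlam0 : (1 + ε) * lam k ≤ lam 0)
    (α : ℝ) (hα : (1 + ε) * lam k < α)
    (x : EuclideanSpace ℝ (Fin d)) (hx : dist x (p k) ≤ lam k) :
    ∃ i < n, i ≠ k ∧
      Real.sqrt (dist x (p i) ^ 2 + (w i α) ^ 2) <
        Real.sqrt (dist x (p k) ^ 2 + (w k α) ^ 2) := by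
  classical
  have hLpos := hlampos k hkn
  have hex : ∃ i, lam i < (1 + ε) * lam k := ⟨k, by nlinarith⟩
  obtain ⟨m, hm, hmin⟩ : ∃ m, lam m < (1 + ε) * lam k ∧
      ∀ j < m, (1 + ε) * lam k ≤ lam j :=
    ⟨Nat.find hex, Nat.find_spec hex, fun j hj => not_lt.mp (Nat.find_min hex hj)⟩
  have hmk : m ≤ k := by
    by_contra! h
    nlinarith [hmin k h]
  have hm1 : 1 ≤ m := by
    rcases Nat.eq_zero_or_pos m with rfl | h
    · exact absurd hlam0 (not_le.mpr hm)
    · exact h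
  have hmn : m < n := hmk.trans_lt hkn
  have hrm : r m < ε * lam k := by
    have h1 := (hlam m hm1 hmn).trans_lt hm
    rw [div_mul_eq_mul_div, div_lt_iff₀ hε, mul_assoc] at h1
    linarith [lt_of_mul_lt_mul_left h1 (by linarith)]
  have hdist : Metric.infDist (p k) (p '' Set.Iio m) < ε * lam k :=
    ((hgreedy m k hmk hkn).trans_eq (hr m hmn).symm).trans_lt hrm
  have hne : (p '' Set.Iio m).Nonempty := ⟨p 0, 0, hm1, rfl⟩
  obtain ⟨_, ⟨j, hj, rfl⟩, hkj⟩ := (Metric.infDist_lt_iff hne).mp hdist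
  have hj' : j < m := hj
  refine ⟨j, hj'.trans hmn, (hj'.trans_le hmk).ne, ?_⟩
  have hlj := hmin j hj'
  have hwj : w j α ^ 2 ≤ α ^ 2 - ((1 + ε) * lam k) ^ 2 := by
    have hpos : 0 < (1 + ε) * lam k := by positivity
    rw [hw]
    split_ifs with h
    · nlinarith
    · rw [Real.sq_sqrt (by nlinarith)]
      nlinarith
  have hwk : w k α ^ 2 = α ^ 2 - lam k ^ 2 := by
    have hlt : lam k < α := by nlinarith
    rw [hw, if_neg hlt.not_gt, Real.sq_sqrt (by nlinarith)]
  have hxj : dist x (p j) < dist x (p k) + ε * lam k :=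
    (dist_triangle x (p k) (p j)).trans_lt (by linarith)
  have hsq : dist x (p j) ^ 2 < (dist x (p k) + ε * lam k) ^ 2 :=
    pow_lt_pow_left₀ hxj dist_nonneg two_ne_zero
  have hcross : ε * lam k * dist x (p k) ≤ ε * lam k * lam k :=
    mul_le_mul_of_nonneg_left hx (by positivity)
  apply Real.sqrt_lt_sqrt (by positivity)
  rw [hwk]
  nlinarith
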